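/- arXiv:2207.08915 — 9 statements merged into one kernel-verified Lean document; each statement's English description precedes it below -/
import Mathlib

section
/- Let N be a positive integer and let D be a negative integer that is a square modulo 4N. Then there exist integers a, b, c with a > 0, c > 0, b² − 4ac = D, N ∣ c, gcd(a, N) = 1, and gcd(a, b, c) = 1. -/
/-- If `N` is a positive integer and `D` a negative integer that is a square modulo `4N`,
then there exist integers `a, b, c` with `a > 0`, `c > 0`, `b² - 4ac = D`, `N ∣ c`,
`gcd(a, N) = 1` and `gcd(a, b, c) = 1`. -/
theorem stmt_1 (N : ℕ) (hN : 0 < N) (D : ℤ) (hD : D < 0)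
    (hsq : ∃ b : ℤ, (4 * (N : ℤ)) ∣ b ^ 2 - D) :
    ∃ a b c : ℤ, 0 < a ∧ 0 < c ∧ b ^ 2 - 4 * a * c = D ∧ (N : ℤ) ∣ c ∧
      Int.gcd a (N : ℤ) = 1 ∧ Int.gcd a (Int.gcd b c : ℤ) = 1 := by
  obtain ⟨b, k, hk⟩ := hsq
  have hN' : (0 : ℤ) < N := by exact_mod_cast hN
  refine ⟨1, b, N * k, one_pos, ?_, by linarith, dvd_mul_right _ _, by simp, by simp⟩
  nlinarith [sq_nonneg b]
end

section
/- Let N be a positive integer and let D be a negative integer with D ≡ 0 or 1 (mod 4), such that N ∣ D if N is odd and 4N ∣ D if N is even. Then there exist integers a, b, c with a > 0, c > 0, N ∣ b, N ∣ c, gcd(a, N) = 1, and b² − 4ac = D. -/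
/-- If `N` is a positive integer and `D < 0` is a discriminant (`D ≡ 0, 1 (mod 4)`) with
`N ∣ D` if `N` is odd and `4N ∣ D` if `N` is even, then there exist integers `a, b, c`
with `a > 0`, `c > 0`, `N ∣ b`, `N ∣ c`, `gcd(a, N) = 1` and `b² - 4ac = D`. -/
theorem stmt_2 (N : ℕ) (hN : 0 < N) (D : ℤ) (hD : D < 0)
    (hdisc : D % 4 = 0 ∨ D % 4 = 1)
    (hodd : Odd N → (N : ℤ) ∣ D) (heven : Even N → (4 * (N : ℤ)) ∣ D) :
    ∃ a b c : ℤ, 0 < a ∧ 0 < c ∧ (N : ℤ) ∣ b ∧ (N : ℤ) ∣ c ∧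
      Int.gcd a (N : ℤ) = 1 ∧ b ^ 2 - 4 * a * c = D := by
  have hcop : Odd N → IsCoprime (N : ℤ) 4 := fun h => by
    have h2 : IsCoprime (N : ℤ) 2 :=
      Nat.isCoprime_iff_coprime.mpr (Nat.coprime_two_right.mpr h)
    exact (show (4 : ℤ) = 2 * 2 by norm_num) ▸ h2.mul_right h2
  rcases hdisc with h0 | h1
  · obtain ⟨k, rfl⟩ : (4 : ℤ) ∣ D := Int.dvd_of_emod_eq_zero h0
    have hk : (N : ℤ) ∣ k := by
      rcases Nat.even_or_odd N with h | h
      · exact (mul_dvd_mul_iff_left four_ne_zero).mp (heven h)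
      · exact (hcop h).dvd_of_dvd_mul_left (hodd h)
    exact ⟨1, 0, -k, one_pos, by linarith, dvd_zero _, hk.neg_right, by simp, by ring⟩
  · have hNodd : Odd N := by
      by_contra h
      have : (4 : ℤ) ∣ D := (dvd_mul_right _ _).trans (heven (Nat.not_odd_iff_even.mp h))
      omega
    have hsq : (N : ℤ) ^ 2 % 4 = 1 :=
      Int.sq_mod_four_eq_one_of_odd (by exact_mod_cast hNodd)
    obtain ⟨k, hk⟩ : (4 : ℤ) ∣ (N : ℤ) ^ 2 - D := by omega
    have hNk : (N : ℤ) ∣ k := (hcop hNodd).dvd_of_dvd_mul_left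
      (hk ▸ dvd_sub (dvd_pow_self _ two_ne_zero) (hodd hNodd))
    exact ⟨1, N, k, one_pos, by nlinarith [sq_nonneg (N : ℤ)], dvd_rfl, hNk, by simp,
      by linarith⟩
end

section
/- Let N be a positive integer and let D be a negative integer that is a square modulo 4N. Suppose D = F²·D₀ for a negative fundamental discriminant D₀ and a positive integer F with gcd(F, N) = 1. Then there exist integers a, b, c with a > 0, c > 0, b² − 4ac = D, N ∣ c, gcd(a, N) = 1, gcd(a, b, c) = 1, and gcd(c/N, N) = 1. -/
/-- If `x`, `y` and `N` have no common prime factor, then some `x + y * t` is coprime to `N`. -/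
theorem exists_add_mul_gcd_eq_one {N : ℕ} (hN : 0 < N) (x y : ℤ)
    (h : ∀ p : ℕ, p.Prime → p ∣ N → (p : ℤ) ∣ x → ¬ (p : ℤ) ∣ y) :
    ∃ t : ℤ, Int.gcd (x + y * t) (N : ℤ) = 1 := by
  classical
  let S : Finset ℕ := N.primeFactors.filter fun p : ℕ => ¬ (p : ℤ) ∣ x
  refine ⟨∏ q ∈ S, (q : ℤ), ?_⟩
  by_contra hne
  obtain ⟨p, hp, hpg⟩ := Nat.exists_prime_and_dvd hne
  have hpx : (p : ℤ) ∣ x + y * ∏ q ∈ S, (q : ℤ) :=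
    (Int.natCast_dvd_natCast.mpr hpg).trans (Int.gcd_dvd_left _ _)
  have hpN : p ∣ N :=
    Int.natCast_dvd_natCast.mp ((Int.natCast_dvd_natCast.mpr hpg).trans (Int.gcd_dvd_right _ _))
  have hp' : Prime (p : ℤ) := Nat.prime_iff_prime_int.mp hp
  by_cases hx : (p : ℤ) ∣ x
  · rcases hp'.dvd_or_dvd ((dvd_add_right hx).mp hpx) with hy | ht
    · exact h p hp hpN hx hy
    · obtain ⟨q, hq, hpq⟩ := hp'.exists_mem_finset_dvd ht
      obtain ⟨hqN, hqx⟩ := Finset.mem_filter.mp hq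
      have hpq' := (Nat.prime_dvd_prime_iff_eq hp (Nat.prime_of_mem_primeFactors hqN)).mp
        (Int.natCast_dvd_natCast.mp hpq)
      exact hqx (hpq' ▸ hx)
  · have hpS : p ∈ S :=
      Finset.mem_filter.mpr ⟨Nat.mem_primeFactors.mpr ⟨hp, hpN, hN.ne'⟩, hx⟩
    exact hx ((dvd_add_left ((Finset.dvd_prod_of_mem (fun q : ℕ => (q : ℤ)) hpS).mul_left y)).mp hpx)

/-- A fundamental discriminant times a square prime to `p` is not `p ^ 2` times a discriminant. -/
theorem sq_mul_fundamental_ne {D₀ F : ℤ} {p : ℕ} (hp : p.Prime) (hpF : ¬ (p : ℤ) ∣ F)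
    (hfund : (D₀ % 4 = 1 ∧ Squarefree D₀) ∨
      ∃ m : ℤ, D₀ = 4 * m ∧ Squarefree m ∧ (m % 4 = 2 ∨ m % 4 = 3)) (u v : ℤ) :
    F ^ 2 * D₀ ≠ (p : ℤ) ^ 2 * (u ^ 2 - 4 * v) := by
  intro heq
  have hp' : Prime (p : ℤ) := Nat.prime_iff_prime_int.mp hp
  have hcop : IsCoprime ((p : ℤ) ^ 2) (F ^ 2) :=
    ((Prime.coprime_iff_not_dvd hp').mpr hpF).pow
  have hdvd : (p : ℤ) ^ 2 ∣ D₀ := hcop.dvd_of_dvd_mul_left ⟨_, heq⟩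
  rcases hfund with ⟨-, hs⟩ | ⟨m, rfl, hs, hm⟩
  · exact hp'.not_isUnit (hs _ (by rwa [← sq]))
  · by_cases h2 : p = 2
    · subst h2
      have hF : F % 2 = 1 := by push_cast at hpF; omega
      have hF4 : F ^ 2 % 4 = 1 := by
        rcases (by omega : F % 4 = 1 ∨ F % 4 = 3) with h | h <;> simp [pow_two, Int.mul_emod, h]
      have hu4 : u ^ 2 % 4 = 0 ∨ u ^ 2 % 4 = 1 := by
        rcases (by omega : u % 4 = 0 ∨ u % 4 = 1 ∨ u % 4 = 2 ∨ u % 4 = 3) with h | h | h | h <;>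
          simp [pow_two, Int.mul_emod, h]
      have hmF : F ^ 2 * m = u ^ 2 - 4 * v := by push_cast at heq; linarith
      have hmod : F ^ 2 * m % 4 = m % 4 := by rw [Int.mul_emod, hF4]; simp
      omega
    · have hc : IsCoprime ((p : ℤ) ^ 2) (2 ^ 2) :=
        (Nat.isCoprime_iff_coprime.mpr ((Nat.coprime_primes hp Nat.prime_two).mpr h2)).pow
      have hpm : (p : ℤ) ^ 2 ∣ m := hc.dvd_of_dvd_mul_left (by norm_num; exact hdvd)
      exact hp'.not_isUnit (hs _ (by rwa [← sq]))


/-- If `N > 0`, `D < 0` is a square modulo `4N` and `D = F² D₀` for a negative fundamental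
discriminant `D₀` and a positive integer `F` coprime to `N`, then there exist `a, b, c`
with `a, c > 0`, `b² - 4ac = D`, `N ∣ c`, `gcd(a,N) = gcd(a,b,c) = gcd(c/N, N) = 1`. -/
theorem stmt_3 (N : ℕ) (hN : 0 < N) (D D₀ F : ℤ) (hD : D < 0)
    (hsq : ∃ b : ℤ, (4 * (N : ℤ)) ∣ b ^ 2 - D)
    (hDeq : D = F ^ 2 * D₀) (hF : 0 < F) (hFN : Int.gcd F (N : ℤ) = 1)
    (hD₀neg : D₀ < 0)
    (hfund : (D₀ % 4 = 1 ∧ Squarefree D₀) ∨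
      ∃ m : ℤ, D₀ = 4 * m ∧ Squarefree m ∧ (m % 4 = 2 ∨ m % 4 = 3)) :
    ∃ a b c : ℤ, 0 < a ∧ 0 < c ∧ b ^ 2 - 4 * a * c = D ∧ (N : ℤ) ∣ c ∧
      Int.gcd a (N : ℤ) = 1 ∧ Int.gcd a (Int.gcd b c : ℤ) = 1 ∧
      Int.gcd (c / (N : ℤ)) (N : ℤ) = 1 := by
  obtain ⟨b, k, hk⟩ := hsq
  obtain ⟨t, ht⟩ := exists_add_mul_gcd_eq_one hN k b (by
    rintro p hp ⟨n, rfl⟩ ⟨w, rfl⟩ ⟨u, rfl⟩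
    have hpF : ¬ (p : ℤ) ∣ F := fun hpF => by
      have hpg := Int.dvd_coe_gcd hpF (by simp : (p : ℤ) ∣ ((p * n : ℕ) : ℤ))
      rw [hFN] at hpg
      exact (Nat.prime_iff_prime_int.mp hp).not_isUnit (isUnit_of_dvd_one (by exact_mod_cast hpg))
    refine sq_mul_fundamental_ne hp hpF hfund u (n * w) ?_
    push_cast at hk
    linear_combination -hDeq - hk)
  have hN' : (0 : ℤ) < N := by exact_mod_cast hN
  have hdisc : (b + 2 * N * t) ^ 2 - D = 4 * N * (k + b * t + N * t ^ 2) := by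
    linear_combination hk
  have hpos : 0 < k + b * t + N * t ^ 2 := by
    refine pos_of_mul_pos_right (a := 4 * (N : ℤ)) ?_ (by positivity)
    rw [← hdisc]
    nlinarith [sq_nonneg (b + 2 * N * t)]
  refine ⟨1, b + 2 * N * t, N * (k + b * t + N * t ^ 2), one_pos, by positivity, ?_,
    dvd_mul_right _ _, by simp, by simp, ?_⟩
  · linear_combination hdisc
  · rw [Int.mul_ediv_cancel_left _ hN'.ne']
    simpa using ht
end

section
/- Let N be a positive integer and let D be a negative integer that is a square modulo 4N. Suppose that none of the following three conditions holds: (1) there exists a prime p ∣ N with ord_p(N) odd and ord_p(D) > ord_p(4N); (2) m := ord_2(N) > 0, ord_2(D) = m+1, and D/2^{m+1} ≡ 1 (mod 4); (3) m := ord_2(N) > 0, ord_2(D) = m, and D/2^m ≡ 1 (mod 8). Then there exists an integer b such that for every prime p dividing N, ord_p(b² − D) = ord_p(4N). -/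
/-- The exponent of `p` in a factorisation with prime-to-`p` cofactor is unique. -/
theorem Prime.pow_mul_left_inj_exponent {p : ℤ} (hp : Prime p) {a b : ℕ} {x y : ℤ}
    (h : p ^ a * x = p ^ b * y) (hx : ¬ p ∣ x) (hy : ¬ p ∣ y) : a = b := by
  have hx' : emultiplicity p (p ^ a * x) = a :=
    emultiplicity_eq_coe.mpr ⟨dvd_mul_right _ _, fun hd => hx <| by
      rwa [pow_succ, mul_dvd_mul_iff_left (pow_ne_zero _ hp.ne_zero)] at hd⟩
  have hy' : emultiplicity p (p ^ b * y) = b :=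
    emultiplicity_eq_coe.mpr ⟨dvd_mul_right _ _, fun hd => hy <| by
      rwa [pow_succ, mul_dvd_mul_iff_left (pow_ne_zero _ hp.ne_zero)] at hd⟩
  rw [h, hy'] at hx'
  exact_mod_cast hx'.symm

/-- If `b² ≡ p ^ d * E` modulo a power of `p` higher than `p ^ d`, with `p ∤ E`, then `d` is even
and `p ^ (d / 2)` is the exact power of `p` in `b`. -/
theorem exists_eq_pow_mul_of_dvd_sq_sub {p : ℤ} (hp : Prime p) {b E : ℤ} {d k : ℕ}
    (hE : ¬ p ∣ E) (hdk : d < k) (hb : p ^ k ∣ b ^ 2 - p ^ d * E) :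
    ∃ (c : ℕ) (u : ℤ), d = 2 * c ∧ b = p ^ c * u ∧ ¬ p ∣ u := by
  obtain ⟨j, rfl⟩ := Nat.exists_eq_add_of_lt hdk
  obtain ⟨m, hm⟩ := hb
  have hb2 : b ^ 2 = p ^ d * (E + p * (p ^ j * m)) := by
    linear_combination hm
  have hE' : ¬ p ∣ E + p * (p ^ j * m) := fun h =>
    hE ((dvd_add_left (dvd_mul_right _ _)).mp h)
  have hb0 : b ≠ 0 := by
    rintro rfl
    have h0 : p ^ d * (E + p * (p ^ j * m)) = 0 := by rw [← hb2]; ring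
    rcases mul_eq_zero.mp h0 with h | h
    · exact pow_ne_zero _ hp.ne_zero h
    · exact hE' (h ▸ dvd_zero p)
  obtain ⟨u, hbu, hu⟩ := (FiniteMultiplicity.of_prime_left hp hb0).exists_eq_pow_mul_and_not_dvd
  refine ⟨_, u, ?_, hbu, hu⟩
  refine hp.pow_mul_left_inj_exponent (x := E + p * (p ^ j * m)) (y := u ^ 2) ?_ hE'
    fun h => hu (hp.dvd_of_dvd_pow h)
  rw [← hb2, hbu, mul_pow, ← pow_mul, ← hbu, mul_comm 2]

/-- A solution of `b² ≡ D` modulo `p ^ k` can be moved by `t` to an exact one when `2bt` has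
valuation exactly `k` and `t²` has larger valuation. -/
theorem exists_sq_sub_exact_of_shift {q b D t : ℤ} {k : ℕ} (hb : q ^ k ∣ b ^ 2 - D)
    (ht : q ^ k ∣ 2 * b * t) (ht' : ¬ q ^ (k + 1) ∣ 2 * b * t) (hsq : q ^ (k + 1) ∣ t ^ 2) :
    ∃ x : ℤ, q ^ k ∣ x ^ 2 - D ∧ ¬ q ^ (k + 1) ∣ x ^ 2 - D := by
  by_cases h : q ^ (k + 1) ∣ b ^ 2 - D
  · have e : (b + t) ^ 2 - D = (b ^ 2 - D) + 2 * b * t + t ^ 2 := by ring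
    refine ⟨b + t, ?_, ?_⟩
    · rw [e]
      exact dvd_add (dvd_add hb ht) ((pow_dvd_pow q k.le_succ).trans hsq)
    · rw [e, dvd_add_left hsq, dvd_add_right h]
      exact ht'
  · exact ⟨b, hb, h⟩

/-- An exact solution of `x² ≡ D` modulo `p ^ k` when the valuation of `D` is at least `k`. -/
theorem exists_sq_sub_exact_of_le {p : ℤ} (hp : Prime p) {E : ℤ} {d k : ℕ} (hE : ¬ p ∣ E)
    (hkd : k ≤ d) (hk : k < d → Even k) :
    ∃ x : ℤ, p ^ k ∣ x ^ 2 - p ^ d * E ∧ ¬ p ^ (k + 1) ∣ x ^ 2 - p ^ d * E := by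
  have hp0 (n : ℕ) : p ^ n ≠ 0 := pow_ne_zero _ hp.ne_zero
  rcases hkd.eq_or_lt with rfl | hlt
  · refine ⟨0, by simp, fun h => hE ?_⟩
    rwa [zero_pow two_ne_zero, zero_sub, dvd_neg, pow_succ, mul_dvd_mul_iff_left (hp0 _)] at h
  · obtain ⟨c, rfl⟩ := hk hlt
    obtain ⟨j, rfl⟩ := Nat.exists_eq_add_of_lt hlt
    have e : (p ^ c) ^ 2 - p ^ (c + c + j + 1) * E = p ^ (c + c) * (1 - p * (p ^ j * E)) := by
      ring
    refine ⟨p ^ c, e ▸ dvd_mul_right _ _, fun h => hp.not_dvd_one ?_⟩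
    rw [e, pow_succ, mul_dvd_mul_iff_left (hp0 _)] at h
    exact (dvd_sub_left (dvd_mul_right _ _)).mp h

/-- Exact solutions at an odd prime. -/
theorem exists_sq_sub_exact_of_odd {p : ℤ} (hp : Prime p) (hp2 : ¬ p ∣ 2) {E : ℤ} {d k : ℕ}
    (hE : ¬ p ∣ E) (hk : k < d → Even k) (hb : ∃ b : ℤ, p ^ k ∣ b ^ 2 - p ^ d * E) :
    ∃ x : ℤ, p ^ k ∣ x ^ 2 - p ^ d * E ∧ ¬ p ^ (k + 1) ∣ x ^ 2 - p ^ d * E := by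
  rcases le_or_gt k d with hkd | hdk
  · exact exists_sq_sub_exact_of_le hp hE hkd hk
  obtain ⟨b, hb⟩ := hb
  obtain ⟨c, u, rfl, rfl, hu⟩ := exists_eq_pow_mul_of_dvd_sq_sub hp hE hdk hb
  have e : 2 * (p ^ c * u) * p ^ (k - c) = p ^ k * (2 * u) := by
    rw [show p ^ k = p ^ c * p ^ (k - c) by rw [← pow_add]; congr 1; omega]; ring
  refine exists_sq_sub_exact_of_shift hb (t := p ^ (k - c)) (e ▸ dvd_mul_right _ _)
    (fun h => ?_) ?_
  · rw [e, pow_succ, mul_dvd_mul_iff_left (pow_ne_zero _ hp.ne_zero)] at h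
    exact (hp.dvd_or_dvd h).elim hp2 hu
  · rw [← pow_mul]
    exact pow_dvd_pow _ (by omega)

/-- Exact solutions at the prime `2`. -/
theorem exists_sq_sub_exact_of_two {E : ℤ} {d n : ℕ} (hE : ¬ (2 : ℤ) ∣ E)
    (hk : n + 2 < d → Even (n + 2)) (hsucc : d = n + 1 → E % 4 ≠ 1) (heq : d = n → E % 8 ≠ 1)
    (hb : ∃ b : ℤ, 2 ^ (n + 2) ∣ b ^ 2 - 2 ^ d * E) :
    ∃ x : ℤ, 2 ^ (n + 2) ∣ x ^ 2 - 2 ^ d * E ∧ ¬ 2 ^ (n + 2 + 1) ∣ x ^ 2 - 2 ^ d * E := by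
  rcases le_or_gt (n + 2) d with hkd | hdk
  · exact exists_sq_sub_exact_of_le Int.prime_two hE hkd hk
  obtain ⟨b, hb⟩ := hb
  obtain ⟨c, u, hd, rfl, hu⟩ := exists_eq_pow_mul_of_dvd_sq_sub Int.prime_two hE hdk hb
  have hu8 : u ^ 2 % 8 = 1 := by
    have := Int.eight_dvd_sq_sub_one_of_odd (Int.not_even_iff_odd.mp (mt Even.two_dvd hu))
    omega
  have e : (2 ^ c * u) ^ 2 - 2 ^ d * E = 2 ^ d * (u ^ 2 - E) := by
    rw [hd]; ring
  have h0 : (2 : ℤ) ^ d ≠ 0 := by positivity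
  rcases lt_trichotomy d n with hlt | rfl | hgt
  · have e' : 2 * (2 ^ c * u) * 2 ^ (n + 1 - c) = 2 ^ (n + 2) * u := by
      rw [show (2 : ℤ) ^ (n + 2) = 2 * 2 ^ c * 2 ^ (n + 1 - c) by
        rw [← pow_succ', ← pow_add]; congr 1; omega]
      ring
    refine exists_sq_sub_exact_of_shift hb (t := 2 ^ (n + 1 - c)) (e' ▸ dvd_mul_right _ _)
      (fun h => hu ?_) ?_
    · rwa [e', pow_succ, mul_dvd_mul_iff_left (by positivity)] at h
    · rw [← pow_mul]
      exact pow_dvd_pow _ (by omega)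
  · refine ⟨_, hb, fun h => ?_⟩
    have heq := heq rfl
    rw [e, add_assoc, pow_add, mul_dvd_mul_iff_left h0] at h
    omega
  · obtain rfl : d = n + 1 := by omega
    refine ⟨_, hb, fun h => ?_⟩
    have hsucc := hsucc rfl
    rw [e, show n + 2 + 1 = n + 1 + 2 by ring, pow_add, mul_dvd_mul_iff_left h0] at h
    omega

/-- Exact square-root conditions at the primes dividing `N` can be met simultaneously. -/
theorem exists_sq_sub_exact_of_local (N : ℕ) (hN : N ≠ 0) (D : ℤ) (k : ℕ → ℕ)
    (h : ∀ p : ℕ, p.Prime → p ∣ N →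
      ∃ x : ℤ, (p : ℤ) ^ k p ∣ x ^ 2 - D ∧ ¬ (p : ℤ) ^ (k p + 1) ∣ x ^ 2 - D) :
    ∃ b : ℤ, ∀ p : ℕ, p.Prime → p ∣ N →
      (p : ℤ) ^ k p ∣ b ^ 2 - D ∧ ¬ (p : ℤ) ^ (k p + 1) ∣ b ^ 2 - D := by
  choose! x hx hx' using h
  obtain ⟨b, hb⟩ := Nat.chineseRemainderOfFinset (fun p => (x p).natAbs)
    (fun p => p ^ (k p + 1)) N.primeFactors
    (fun p hp => pow_ne_zero _ (Nat.prime_of_mem_primeFactors hp).ne_zero)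
    (fun p hp q hq hpq => Nat.Coprime.pow _ _ <| (Nat.coprime_primes
      (Nat.prime_of_mem_primeFactors hp) (Nat.prime_of_mem_primeFactors hq)).mpr hpq)
  refine ⟨b, fun p hp hpN => ?_⟩
  have hmod := ((Int.natCast_modEq_iff.mpr (hb p (hp.mem_primeFactors hpN hN))).pow 2).dvd
  rw [Int.natCast_natAbs, sq_abs] at hmod
  push_cast at hmod
  have e : (b : ℤ) ^ 2 - D = (x p ^ 2 - D) - (x p ^ 2 - b ^ 2) := by ring
  rw [e, dvd_sub_left hmod, dvd_sub_left ((pow_dvd_pow _ (Nat.le_succ _)).trans hmod)]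
  exact ⟨hx p hp hpN, hx' p hp hpN⟩

theorem padicValInt_eq_of_dvd_of_not_dvd {p : ℕ} [Fact p.Prime] {z : ℤ} {k : ℕ}
    (h : (p : ℤ) ^ k ∣ z) (h' : ¬ (p : ℤ) ^ (k + 1) ∣ z) : padicValInt p z = k := by
  rw [padicValInt_dvd_iff] at h h'
  push Not at h'
  have := h.resolve_left h'.1
  omega

/-- Let `N > 0` and let `D < 0` be a square modulo `4N`. If none of the three exceptional
conditions holds, then there is an integer `b` with `ord_p(b² - D) = ord_p(4N)` for all
primes `p ∣ N`. -/
theorem stmt_4 (N : ℕ) (hN : 0 < N) (D : ℤ) (hD : D < 0)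
    (hsq : ∃ b : ℤ, (4 * (N : ℤ)) ∣ b ^ 2 - D)
    (h1 : ¬ ∃ p : ℕ, p.Prime ∧ p ∣ N ∧ Odd (padicValNat p N) ∧
      padicValNat p (4 * N) < padicValInt p D)
    (h2 : ¬ (0 < padicValNat 2 N ∧ padicValInt 2 D = padicValNat 2 N + 1 ∧
      (D / 2 ^ (padicValNat 2 N + 1)) % 4 = 1))
    (h3 : ¬ (0 < padicValNat 2 N ∧ padicValInt 2 D = padicValNat 2 N ∧
      (D / 2 ^ (padicValNat 2 N)) % 8 = 1)) :
    ∃ b : ℤ, ∀ p : ℕ, p.Prime → p ∣ N →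
      padicValInt p (b ^ 2 - D) = padicValNat p (4 * N) := by
  obtain ⟨b₀, hb₀⟩ := hsq
  suffices h : ∀ p : ℕ, p.Prime → p ∣ N → ∃ x : ℤ,
      (p : ℤ) ^ padicValNat p (4 * N) ∣ x ^ 2 - D ∧
        ¬ (p : ℤ) ^ (padicValNat p (4 * N) + 1) ∣ x ^ 2 - D by
    obtain ⟨b, hb⟩ := exists_sq_sub_exact_of_local N hN.ne' D _ h
    refine ⟨b, fun p hp hpN => ?_⟩
    have : Fact p.Prime := ⟨hp⟩
    exact padicValInt_eq_of_dvd_of_not_dvd (hb p hp hpN).1 (hb p hp hpN).2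
  intro p hp hpN
  have : Fact p.Prime := ⟨hp⟩
  have hpi : Prime (p : ℤ) := Nat.prime_iff_prime_int.mp hp
  obtain ⟨E, hE⟩ := padicValInt_dvd (p := p) D
  have hpE : ¬ (p : ℤ) ∣ E := by
    rintro ⟨m, rfl⟩
    have : (p : ℤ) ^ (padicValInt p D + 1) ∣ D := ⟨m, by rw [pow_succ]; linear_combination hE⟩
    rw [padicValInt_dvd_iff] at this
    omega
  have hdvd : (p : ℤ) ^ padicValNat p (4 * N) ∣ b₀ ^ 2 - D :=
    (by exact_mod_cast pow_padicValNat_dvd : (p : ℤ) ^ padicValNat p (4 * N) ∣ 4 * N).trans hb₀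
  have hmul : padicValNat p (4 * N) = padicValNat p 4 + padicValNat p N :=
    padicValNat.mul (by norm_num) hN.ne'
  have hpos : 0 < padicValNat p N :=
    Nat.pos_of_ne_zero (dvd_iff_padicValNat_ne_zero hN.ne' |>.mp hpN)
  have heven : padicValNat p (4 * N) < padicValInt p D → Even (padicValNat p N) := fun hlt =>
    Nat.not_odd_iff_even.mp fun hodd => h1 ⟨p, hp, hpN, hodd, hlt⟩
  set d := padicValInt p D
  by_cases hp2 : p = 2
  · subst hp2
    have h4 : padicValNat 2 4 = 2 := padicValNat.prime_pow (p := 2) 2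
    rw [h4, add_comm] at hmul
    rw [hmul] at hdvd heven ⊢
    rw [hE] at hdvd ⊢
    have hdiv : D / 2 ^ d = E := Int.ediv_eq_of_eq_mul_right (by positivity) hE
    refine exists_sq_sub_exact_of_two hpE (fun hlt => (heven hlt).add even_two)
      (fun h hmod => h2 ⟨hpos, h, ?_⟩) (fun h hmod => h3 ⟨hpos, h, ?_⟩) ⟨b₀, hdvd⟩
    · rwa [← h, hdiv]
    · rwa [← h, hdiv]
  · have hp2' : ¬ p ∣ 2 := fun h => hp2 ((Nat.prime_dvd_prime_iff_eq hp Nat.prime_two).mp h)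
    have h4 : padicValNat p 4 = 0 := padicValNat.eq_zero_of_not_dvd fun h =>
      hp2' (hp.dvd_of_dvd_pow (n := 2) h)
    rw [h4, zero_add] at hmul
    rw [hmul] at hdvd heven ⊢
    rw [hE] at hdvd ⊢
    exact exists_sq_sub_exact_of_odd hpi (by exact_mod_cast hp2') hpE heven ⟨b₀, hdvd⟩
end

section
/- Let N be a positive integer and let D be a negative integer that is a square modulo 4N. Suppose that at least one of the following three conditions holds: (1) there exists a prime p ∣ N with ord_p(N) odd and ord_p(D) > ord_p(4N); (2) m := ord_2(N) > 0, ord_2(D) = m+1, and D/2^{m+1} ≡ 1 (mod 4); (3) m := ord_2(N) > 0, ord_2(D) = m, and D/2^m ≡ 1 (mod 8). Then there exists no integer b such that for every prime p dividing N, ord_p(b² − D) = ord_p(4N). -/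
/-- If `p ^ k` exactly divides the square `b ^ 2`, then `k` is
even and the cofactor is itself a square. -/
theorem even_and_isSquare_of_sq_eq_prime_pow_mul {R : Type*} [CommRing R] [IsDomain R] {p x : R}
    (hp : Prime p) (hx : ¬ p ∣ x) (k : ℕ) (b : R) (h : b ^ 2 = p ^ k * x) :
    Even k ∧ ∃ c, x = c ^ 2 := by
  induction k using Nat.twoStepInduction generalizing b with
  | zero => exact ⟨Even.zero, b, by simpa using h.symm⟩
  | one =>
    obtain ⟨c, rfl⟩ : p ∣ b := hp.dvd_of_dvd_pow (n := 2) (h ▸ by simp)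
    exact absurd ⟨c ^ 2, mul_left_cancel₀ hp.ne_zero (by linear_combination -h)⟩ hx
  | more k ih _ =>
    obtain ⟨c, rfl⟩ : p ∣ b :=
      hp.dvd_of_dvd_pow (n := 2) (h ▸ (dvd_pow_self p (by simp)).mul_right x)
    obtain ⟨hk, hc⟩ := ih c
      (mul_left_cancel₀ (pow_ne_zero 2 hp.ne_zero) (by linear_combination h))
    exact ⟨hk.add even_two, hc⟩

theorem exists_eq_pow_padicValInt_mul (p : ℕ) [Fact p.Prime] {n : ℤ} (hn : n ≠ 0) :
    ∃ w : ℤ, n = (p : ℤ) ^ padicValInt p n * w ∧ ¬ (p : ℤ) ∣ w := by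
  obtain ⟨w, hw⟩ : (p : ℤ) ^ padicValInt p n ∣ n := padicValInt_dvd n
  refine ⟨w, hw, fun ⟨v, hv⟩ => ?_⟩
  have h : (p : ℤ) ^ (padicValInt p n + 1) ∣ n := ⟨v, by rw [pow_succ, mul_assoc, ← hv, ← hw]⟩
  rcases (padicValInt_dvd_iff _ _).1 h with h | h
  · exact hn h
  · omega

theorem padicValNat_two_four_mul {N : ℕ} (hN : N ≠ 0) :
    padicValNat 2 (4 * N) = padicValNat 2 N + 2 := by
  rw [padicValNat.mul (by simp) hN, show 4 = 2 ^ 2 from rfl, padicValNat.prime_pow, add_comm]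

theorem odd_padicValNat_four_mul {p N : ℕ} [hp : Fact p.Prime] (hN : N ≠ 0)
    (h : Odd (padicValNat p N)) : Odd (padicValNat p (4 * N)) := by
  rw [padicValNat.mul (by simp) hN, show 4 = 2 ^ 2 from rfl, padicValNat.pow]
  exact (even_two_mul _).add_odd h

/-- Let `N > 0` and let `D < 0` be a square modulo `4N`. If at least one of the three
exceptional conditions holds, then there is no integer `b` with `ord_p(b² - D) = ord_p(4N)`
for all primes `p ∣ N`. -/
theorem stmt_5 (N : ℕ) (hN : 0 < N) (D : ℤ) (hD : D < 0)
    (hsq : ∃ b : ℤ, (4 * (N : ℤ)) ∣ b ^ 2 - D)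
    (hexc : (∃ p : ℕ, p.Prime ∧ p ∣ N ∧ Odd (padicValNat p N) ∧
        padicValNat p (4 * N) < padicValInt p D) ∨
      (0 < padicValNat 2 N ∧ padicValInt 2 D = padicValNat 2 N + 1 ∧
        (D / 2 ^ (padicValNat 2 N + 1)) % 4 = 1) ∨
      (0 < padicValNat 2 N ∧ padicValInt 2 D = padicValNat 2 N ∧
        (D / 2 ^ (padicValNat 2 N)) % 8 = 1)) :
    ¬ ∃ b : ℤ, ∀ p : ℕ, p.Prime → p ∣ N →
      padicValInt p (b ^ 2 - D) = padicValNat p (4 * N) := by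
  rintro ⟨b, hb⟩
  have hne : b ^ 2 - D ≠ 0 := by nlinarith [sq_nonneg b]
  have two_adic (hm : 0 < padicValNat 2 N) :
      ∃ w : ℤ, b ^ 2 - D = 2 ^ (padicValNat 2 N + 2) * w ∧ ¬ (2 : ℤ) ∣ w := by
    obtain ⟨w, hw, hw'⟩ := exists_eq_pow_padicValInt_mul 2 hne
    rw [hb 2 Nat.prime_two (dvd_of_one_le_padicValNat hm), padicValNat_two_four_mul hN.ne'] at hw
    exact ⟨w, hw, hw'⟩
  rcases hexc with ⟨p, hp, hpN, hodd, hlt⟩ | ⟨hm, hv, hu⟩ | ⟨hm, hv, hu⟩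
  · have := Fact.mk hp
    obtain ⟨w, hw, hw'⟩ := exists_eq_pow_padicValInt_mul p hne
    rw [hb p hp hpN] at hw
    obtain ⟨d, hd⟩ : (p : ℤ) ^ (padicValNat p (4 * N) + 1) ∣ D :=
      (padicValInt_dvd_iff _ _).2 (Or.inr hlt)
    have hx : ¬ (p : ℤ) ∣ w + p * d := by
      rwa [dvd_add_left (dvd_mul_right _ _)]
    have heven := (even_and_isSquare_of_sq_eq_prime_pow_mul (Nat.prime_iff_prime_int.1 hp) hx (padicValNat p (4 * N)) b
      (by linear_combination hw + hd)).1
    exact Nat.not_even_iff_odd.2 (odd_padicValNat_four_mul hN.ne' hodd) heven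
  · obtain ⟨w, hw, hw'⟩ := two_adic hm
    obtain ⟨u, hu', -⟩ := exists_eq_pow_padicValInt_mul 2 hD.ne
    rw [hv, Nat.cast_ofNat] at hu'
    rw [hu', Int.mul_ediv_cancel_left _ (by positivity)] at hu
    obtain ⟨-, c, hc⟩ := even_and_isSquare_of_sq_eq_prime_pow_mul Int.prime_two
      (x := u + 2 * w) (by omega) (padicValNat 2 N + 1) b (by linear_combination hw + hu')
    have := Int.sq_mod_four_eq_one_of_odd (x := c) (by
      rw [← Int.odd_pow' (n := 2) (by simp), ← hc, Int.odd_iff]; omega)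
    omega
  · obtain ⟨w, hw, hw'⟩ := two_adic hm
    obtain ⟨u, hu', -⟩ := exists_eq_pow_padicValInt_mul 2 hD.ne
    rw [hv, Nat.cast_ofNat] at hu'
    rw [hu', Int.mul_ediv_cancel_left _ (by positivity)] at hu
    obtain ⟨-, c, hc⟩ := even_and_isSquare_of_sq_eq_prime_pow_mul Int.prime_two
      (x := u + 4 * w) (by omega) (padicValNat 2 N) b (by linear_combination hw + hu')
    have := Int.eight_dvd_sq_sub_one_of_odd (k := c) (by
      rw [← Int.odd_pow' (n := 2) (by simp), ← hc, Int.odd_iff]; omega)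
    omega
end

section
/- Let N be a positive integer and let D be a negative integer that is a square modulo 4N. Then the following are equivalent: (i) there exist integers a, b, c with a > 0, c > 0, b² − 4ac = D, N ∣ c, gcd(a, N) = 1, gcd(a, b, c) = 1, and gcd(c/N, N) = 1; (ii) there exists an integer b such that for every prime p dividing N, ord_p(b² − D) = ord_p(4N). -/
theorem padicValInt_eq_iff_dvd_not_dvd {p : ℕ} [Fact p.Prime] {x : ℤ} (hx : x ≠ 0) (n : ℕ) :
    padicValInt p x = n ↔ (p : ℤ) ^ n ∣ x ∧ ¬ (p : ℤ) ^ (n + 1) ∣ x := by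
  rw [padicValInt_dvd_iff, padicValInt_dvd_iff]
  simp only [hx, false_or]
  omega

/-- For odd `N`, the local conditions at the primes dividing `N` can be met by an integer of any
prescribed parity. -/
theorem exists_padicValInt_sq_sub_eq_of_odd {N : ℕ} (hN : Odd N) {D : ℤ} (hD : D < 0)
    {b : ℤ} (hb : ∀ p : ℕ, p.Prime → p ∣ N →
      padicValInt p (b ^ 2 - D) = padicValNat p (4 * N)) (b₀ : ℤ) :
    ∃ b' : ℤ, (2 : ℤ) ∣ b' - b₀ ∧ ∀ p : ℕ, p.Prime → p ∣ N →
      padicValInt p (b' ^ 2 - D) = padicValNat p (4 * N) := by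
  have hN0 : N ≠ 0 := hN.pos.ne'
  refine ⟨b + N ^ 2 * (b - b₀), ?_, fun p hp hpN => ?_⟩
  · obtain ⟨k, rfl⟩ := hN
    exact ⟨(b - b₀) * (2 * k ^ 2 + 2 * k + 1), by push_cast; ring⟩
  · have := Fact.mk hp
    have hp2 : ¬ p ∣ 4 := fun h => by
      have h2 : p = 2 := (Nat.prime_dvd_prime_iff_eq hp Nat.prime_two).1
        (hp.dvd_of_dvd_pow (show p ∣ 2 ^ 2 from h))
      exact (Nat.not_even_iff_odd.2 hN) (even_iff_two_dvd.2 (h2 ▸ hpN))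
    have hv : padicValNat p (4 * N) = padicValNat p N := by
      rw [padicValNat.mul (by norm_num) hN0, padicValNat.eq_zero_of_not_dvd hp2, zero_add]
    have hpos : 1 ≤ padicValNat p N := one_le_padicValNat_of_dvd hN0 hpN
    have hdvd : (p : ℤ) ^ (padicValNat p (4 * N) + 1) ∣ (N : ℤ) ^ 2 := by
      have : p ^ (padicValNat p (4 * N) + 1) ∣ N ^ 2 := by
        rw [padicValNat_dvd_iff_le (pow_ne_zero 2 hN0), padicValNat.pow]
        omega
      exact_mod_cast this
    have key : (b + N ^ 2 * (b - b₀)) ^ 2 - D =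
        (b ^ 2 - D) + (N : ℤ) ^ 2 * (2 * b * (b - b₀) + N ^ 2 * (b - b₀) ^ 2) := by ring
    have h := hb p hp hpN
    rw [padicValInt_eq_iff_dvd_not_dvd (by nlinarith [sq_nonneg b])] at h
    rw [padicValInt_eq_iff_dvd_not_dvd (by nlinarith [sq_nonneg (b + N ^ 2 * (b - b₀))]), key,
      dvd_add_left (((pow_dvd_pow _ (Nat.le_succ _)).trans hdvd).mul_right _),
      dvd_add_left (hdvd.mul_right _)]
    exact h

/-- If `D` is a square modulo `4`, the local conditions at the primes dividing `N` can be met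
together with `4 ∣ b ^ 2 - D`. -/
theorem exists_four_dvd_and_padicValInt_sq_sub_eq {N : ℕ} (hN : 0 < N) {D : ℤ} (hD : D < 0)
    {b₀ : ℤ} (h₀ : (4 : ℤ) ∣ b₀ ^ 2 - D) {b : ℤ} (hb : ∀ p : ℕ, p.Prime → p ∣ N →
      padicValInt p (b ^ 2 - D) = padicValNat p (4 * N)) :
    ∃ b' : ℤ, (4 : ℤ) ∣ b' ^ 2 - D ∧ ∀ p : ℕ, p.Prime → p ∣ N →
      padicValInt p (b' ^ 2 - D) = padicValNat p (4 * N) := by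
  rcases Nat.even_or_odd N with he | ho
  · refine ⟨b, ?_, hb⟩
    have h4 : ((2 : ℕ) : ℤ) ^ 2 ∣ b ^ 2 - D := by
      rw [padicValInt_dvd_iff, hb 2 Nat.prime_two he.two_dvd]
      exact .inr ((padicValNat_dvd_iff_le (by omega)).1 (Dvd.intro N (by norm_num)))
    simpa using h4
  · obtain ⟨b', ⟨k, hk⟩, hb'⟩ := exists_padicValInt_sq_sub_eq_of_odd ho hD hb b₀
    refine ⟨b', ?_, hb'⟩
    have : b' ^ 2 - D = (b₀ ^ 2 - D) + 4 * (k * b₀ + k ^ 2) := by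
      rw [show b' = b₀ + 2 * k by linarith]; ring
    exact this ▸ dvd_add h₀ (dvd_mul_right _ _)

/-- Let `N > 0` and let `D < 0` be a square modulo `4N`. Then there is a triple `(a, b, c)`
as in Proposition 4.1 with moreover `gcd(c/N, N) = 1` if and only if there is an integer
`b` with `ord_p(b² - D) = ord_p(4N)` for all primes `p ∣ N`. -/
theorem stmt_6 (N : ℕ) (hN : 0 < N) (D : ℤ) (hD : D < 0)
    (hsq : ∃ b : ℤ, (4 * (N : ℤ)) ∣ b ^ 2 - D) :
    (∃ a b c : ℤ, 0 < a ∧ 0 < c ∧ b ^ 2 - 4 * a * c = D ∧ (N : ℤ) ∣ c ∧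
        Int.gcd a (N : ℤ) = 1 ∧ Int.gcd a (Int.gcd b c : ℤ) = 1 ∧
        Int.gcd (c / (N : ℤ)) (N : ℤ) = 1) ↔
      (∃ b : ℤ, ∀ p : ℕ, p.Prime → p ∣ N →
        padicValInt p (b ^ 2 - D) = padicValNat p (4 * N)) := by
  have hN0 : (N : ℤ) ≠ 0 := by exact_mod_cast hN.ne'
  constructor
  · rintro ⟨a, b, c, ha, hc, hD', ⟨m, rfl⟩, haN, -, hmN⟩
    rw [Int.mul_ediv_cancel_left _ hN0] at hmN
    refine ⟨b, fun p hp hpN => ?_⟩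
    have := Fact.mk hp
    have hzero : ∀ x : ℤ, Int.gcd x N = 1 → padicValInt p x = 0 := fun x hx =>
      padicValInt.eq_zero_of_not_dvd fun h => hp.one_lt.ne'
        (Nat.dvd_one.1 (hx ▸ Int.dvd_gcd h (Int.natCast_dvd_natCast.2 hpN)))
    have hm : m ≠ 0 := right_ne_zero_of_mul hc.ne'
    rw [show b ^ 2 - D = ((4 * N : ℕ) : ℤ) * (a * m) by push_cast; linarith,
      padicValInt.mul (by exact_mod_cast (by omega : 4 * N ≠ 0)) (mul_ne_zero ha.ne' hm),
      padicValInt.mul ha.ne' hm, hzero a haN, hzero m hmN, padicValInt.of_nat, add_zero, add_zero]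
  · rintro ⟨b₁, hb₁⟩
    obtain ⟨b₀, h₀⟩ := hsq
    obtain ⟨b, h4, hb⟩ :=
      exists_four_dvd_and_padicValInt_sq_sub_eq hN hD ((dvd_mul_right _ _).trans h₀) hb₁
    have hpos : 0 < b ^ 2 - D := by nlinarith [sq_nonneg b]
    have hdvd : ((4 * N : ℕ) : ℤ) ∣ b ^ 2 - D := by
      rw [Int.natCast_dvd, Nat.dvd_iff_prime_pow_dvd_dvd]
      intro p k hp hk
      have := Fact.mk hp
      rw [← Int.natCast_dvd, Nat.cast_pow]
      by_cases hpN : p ∣ N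
      · rw [padicValInt_dvd_iff, hb p hp hpN]
        exact .inr ((padicValNat_dvd_iff_le (by omega)).1 hk)
      · have hcop : Nat.Coprime (p ^ k) N := ((Nat.Prime.coprime_iff_not_dvd hp).2 hpN).pow_left k
        exact_mod_cast (Int.natCast_dvd_natCast.2 (hcop.dvd_of_dvd_mul_right hk)).trans h4
    obtain ⟨m, hm⟩ := hdvd
    have hm0 : 0 < m := pos_of_mul_pos_right (hm ▸ hpos) (by positivity)
    refine ⟨1, b, N * m, one_pos, by positivity, ?_, dvd_mul_right _ _, by simp, by simp, ?_⟩
    · push_cast at hm; linarith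
    · rw [Int.mul_ediv_cancel_left _ hN0]
      refine Nat.eq_one_iff_not_exists_prime_dvd.2 fun p hp h => ?_
      have hpm : (p : ℤ) ∣ m := (Int.natCast_dvd_natCast.2 h).trans (Int.gcd_dvd_left ..)
      have hpN : p ∣ N := Int.natCast_dvd_natCast.1
        ((Int.natCast_dvd_natCast.2 h).trans (Int.gcd_dvd_right ..))
      have := Fact.mk hp
      have hv := hb p hp hpN
      rw [hm, padicValInt.mul (by exact_mod_cast (by omega : 4 * N ≠ 0)) hm0.ne',
        padicValInt.of_nat] at hv
      have := (padicValInt_dvd_iff (p := p) 1 m).1 (by simpa using hpm)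
      omega
end

section
/- Let p be an odd prime, let D be a nonzero integer whose p-adic valuation l := ord_p(D) is even, let k be an integer with k > l, and let b₀ be an integer with ord_p(b₀² − D) > k. Then the integer b = b₀ + p^{k − l/2} satisfies ord_p(b² − D) = k. -/
/-- Let `p` be an odd prime, `D ≠ 0` with `l := ord_p(D)` even, `k > l`, and `b₀` with
`ord_p(b₀² - D) > k`. Then `b = b₀ + p^(k - l/2)` satisfies `ord_p(b² - D) = k`. -/
theorem stmt_7 (p : ℕ) (hp : p.Prime) (hpodd : Odd p) (D : ℤ) (hD : D ≠ 0)
    (l : ℕ) (hl : l = padicValInt p D) (hleven : Even l)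
    (k : ℕ) (hk : l < k) (b₀ : ℤ) (hb₀ : k < padicValInt p (b₀ ^ 2 - D)) :
    padicValInt p ((b₀ + (p : ℤ) ^ (k - l / 2)) ^ 2 - D) = k := by
  have : Fact p.Prime := ⟨hp⟩
  have hpZ : Prime (p : ℤ) := Nat.prime_iff_prime_int.mp hp
  obtain ⟨m, rfl⟩ := hleven
  have hm : (m + m) / 2 = m := by omega
  rw [hm]
  have hdvd : (p : ℤ) ^ (k + 1) ∣ b₀ ^ 2 - D := (padicValInt_dvd_iff _ _).2 (Or.inr hb₀)
  have hDdvd : (p : ℤ) ^ (m + m) ∣ D := (padicValInt_dvd_iff _ _).2 (Or.inr hl.le)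
  have hDndvd : ¬ (p : ℤ) ^ (m + m + 1) ∣ D := by
    rw [padicValInt_dvd_iff, not_or]
    exact ⟨hD, by omega⟩
  obtain ⟨c, rfl⟩ : (p : ℤ) ^ m ∣ b₀ := by
    rw [← Int.pow_dvd_pow_iff two_ne_zero, ← pow_mul, mul_two]
    exact (dvd_iff_dvd_of_dvd_sub ((pow_dvd_pow _ (by omega)).trans hdvd)).2 hDdvd
  have hc : ¬ (p : ℤ) ∣ c := by
    rintro ⟨d, rfl⟩
    refine hDndvd ((dvd_iff_dvd_of_dvd_sub ((pow_dvd_pow _ (by omega)).trans hdvd)).1 ?_)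
    exact ⟨p * d ^ 2, by ring⟩
  have hp2 : ¬ (p : ℤ) ∣ 2 := by
    intro h
    have h2 : p ∣ 2 := by exact_mod_cast h
    rw [Nat.prime_dvd_prime_iff_eq hp Nat.prime_two] at h2
    subst h2
    exact absurd hpodd (by decide)
  obtain ⟨t, ht⟩ := hdvd
  obtain ⟨j, rfl⟩ : ∃ j, k = m + m + 1 + j := ⟨k - (m + m + 1), by omega⟩
  have hj : m + m + 1 + j - m = m + 1 + j := by omega
  have hfactor : ((p : ℤ) ^ m * c + (p : ℤ) ^ (m + 1 + j)) ^ 2 - D =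
      (p : ℤ) ^ (m + m + 1 + j) * (p * (t + p ^ j) + 2 * c) := by
    linear_combination ht
  have hunit : ¬ (p : ℤ) ∣ p * (t + p ^ j) + 2 * c := by
    rw [dvd_add_right (dvd_mul_right _ _), hpZ.dvd_mul]
    tauto
  have hunit0 : (p : ℤ) * (t + p ^ j) + 2 * c ≠ 0 := fun h => hunit (h ▸ dvd_zero _)
  rw [hj, hfactor, padicValInt.mul (pow_ne_zero _ hpZ.ne_zero) hunit0,
    padicValInt.eq_zero_of_not_dvd hunit, ← Nat.cast_pow, padicValInt.of_nat,
    padicValNat.prime_pow, add_zero]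
end

section
/- Let D be a nonzero integer whose 2-adic valuation l := ord_2(D) is even, let k be an integer with k > l + 2, and let b₀ be an integer with ord_2(b₀² − D) > k. Then the integer b = b₀ + 2^{k − l/2 − 1} satisfies ord_2(b² − D) = k. -/
theorem padicValInt_two_pow_mul_odd (n : ℕ) {a : ℤ} (ha : Odd a) :
    padicValInt 2 (2 ^ n * a) = n := by
  have ha' : ¬ (2 : ℤ) ∣ a := by
    rwa [← even_iff_two_dvd, Int.not_even_iff_odd]
  have ha0 : a ≠ 0 := by
    rintro rfl
    simp at ha'
  rw [padicValInt, Int.natAbs_mul, Int.natAbs_pow, padicValNat.mul (by simp) (by simpa),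
    show Int.natAbs 2 = 2 from rfl, padicValNat.prime_pow,
    padicValNat.eq_zero_of_not_dvd (fun h => ha' (by omega)), add_zero]

theorem exists_odd_eq_two_pow_padicValInt_mul {a : ℤ} (ha : a ≠ 0) :
    ∃ u : ℤ, Odd u ∧ a = 2 ^ padicValInt 2 a * u := by
  obtain ⟨u, hu⟩ : (2 : ℤ) ^ padicValInt 2 a ∣ a := by
    simpa using padicValInt_dvd (p := 2) a
  refine ⟨u, ?_, hu⟩
  rw [← Int.not_even_iff_odd, even_iff_two_dvd]
  rintro ⟨v, rfl⟩
  have h : ((2 : ℕ) : ℤ) ^ (padicValInt 2 a + 1) ∣ a :=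
    ⟨v, by push_cast; rw [pow_succ, mul_assoc]; exact hu⟩
  rw [padicValInt_dvd_iff] at h
  omega

/-- Let `D ≠ 0` with `l := ord_2(D)` even, `k > l + 2`, and `b₀` with
`ord_2(b₀² - D) > k`. Then `b = b₀ + 2^(k - l/2 - 1)` satisfies `ord_2(b² - D) = k`. -/
theorem stmt_8 (D : ℤ) (hD : D ≠ 0)
    (l : ℕ) (hl : l = padicValInt 2 D) (hleven : Even l)
    (k : ℕ) (hk : l + 2 < k) (b₀ : ℤ) (hb₀ : k < padicValInt 2 (b₀ ^ 2 - D)) :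
    padicValInt 2 ((b₀ + (2 : ℤ) ^ (k - l / 2 - 1)) ^ 2 - D) = k := by
  obtain ⟨m, rfl⟩ := hleven
  obtain ⟨j, rfl⟩ : ∃ j, k = m + m + 3 + j := ⟨k - (m + m + 3), by omega⟩
  obtain ⟨u, hu, hDu⟩ := exists_odd_eq_two_pow_padicValInt_mul hD
  rw [← hl] at hDu
  obtain ⟨c, hc⟩ : (2 : ℤ) ^ (m + m + 3 + j + 1) ∣ b₀ ^ 2 - D := by
    have := (padicValInt_dvd_iff (p := 2) (m + m + 3 + j + 1) (b₀ ^ 2 - D)).2 (Or.inr hb₀)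
    simpa using this
  have hsq : b₀ ^ 2 = (2 ^ m) ^ 2 * (u + 2 * (2 ^ (3 + j) * c)) := by
    rw [eq_add_of_sub_eq hc, hDu]
    ring
  obtain ⟨o, rfl⟩ : (2 : ℤ) ^ m ∣ b₀ :=
    (Int.pow_dvd_pow_iff two_ne_zero).1 ⟨_, hsq⟩
  have ho : Odd o := by
    rw [mul_pow] at hsq
    have hsq' := mul_left_cancel₀ (by positivity) hsq
    have : Odd (o ^ 2) := hsq' ▸ hu.add_even (even_two_mul _)
    exact (Int.odd_pow' two_ne_zero).1 this
  have hexp : m + m + 3 + j - (m + m) / 2 - 1 = m + 2 + j := by omega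
  have key : (2 ^ m * o + (2 : ℤ) ^ (m + 2 + j)) ^ 2 - D =
      2 ^ (m + m + 3 + j) * (o + 2 * (c + 2 ^ j)) := by
    linear_combination hc
  rw [hexp, key]
  exact padicValInt_two_pow_mul_odd _ (ho.add_even (even_two_mul _))
end

section
/- The negative fundamental discriminants have natural density 3/π² among the negative integers; that is, (1/X)·#{n ∈ ℤ : 1 ≤ n ≤ X and −n is a fundamental discriminant} tends to 3/π² as X → ∞. -/
open scoped Classical

open Filter Finset ArithmeticFunction
open scoped ArithmeticFunction.Moebius ArithmeticFunction.zeta Topology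

/-- The number of positive integers `n ≤ X` satisfying `p`. -/
noncomputable def natCount (p : ℕ → Prop) (X : ℕ) : ℕ := ((Icc 1 X).filter p).card

/-- The set of positive integers satisfying `p` has natural density `a`. -/
def HasNatDensity (p : ℕ → Prop) (a : ℝ) : Prop :=
  Tendsto (fun X : ℕ => (natCount p X : ℝ) / X) atTop (𝓝 a)

theorem HasNatDensity.or {p q : ℕ → Prop} {a b : ℝ} (hp : HasNatDensity p a)
    (hq : HasNatDensity q b) (hpq : ∀ n, p n → ¬ q n) :
    HasNatDensity (fun n => p n ∨ q n) (a + b) := by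
  refine (Tendsto.add hp hq).congr fun X => ?_
  rw [← add_div, ← Nat.cast_add, natCount, natCount, natCount,
    ← card_union_of_disjoint (disjoint_filter.mpr fun n _ => hpq n), ← filter_or]
  congr!

theorem natCount_mul (p : ℕ → Prop) {k : ℕ} (hk : 0 < k) (X : ℕ) :
    natCount (fun n => ∃ m, n = k * m ∧ p m) X = natCount p (X / k) := by
  symm
  refine card_bij (fun m _ => k * m) ?_ ?_ ?_
  · simp only [mem_filter, mem_Icc]
    rintro m ⟨⟨h1, h2⟩, h3⟩
    exact ⟨⟨Nat.mul_pos hk h1, by rwa [mul_comm, ← Nat.le_div_iff_mul_le hk]⟩, m, rfl, h3⟩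
  · intro a _ b _ h
    exact Nat.eq_of_mul_eq_mul_left hk h
  · simp only [mem_filter, mem_Icc]
    rintro n ⟨⟨h1, h2⟩, m, rfl, h3⟩
    exact ⟨m, ⟨⟨Nat.pos_of_mul_pos_left h1, by rwa [Nat.le_div_iff_mul_le hk, mul_comm]⟩, h3⟩, rfl⟩

theorem tendsto_natCast_div_div (k : ℕ) :
    Tendsto (fun X : ℕ => ((X / k : ℕ) : ℝ) / X) atTop (𝓝 (1 / k)) := by
  refine ((tendsto_nat_floor_mul_div_atTop (R := ℝ) (a := 1 / k) (by positivity)).comp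
    tendsto_natCast_atTop_atTop).congr fun X => ?_
  simp only [Function.comp_apply]
  rw [one_div_mul_eq_div, Nat.floor_div_eq_div]

theorem HasNatDensity.mul {p : ℕ → Prop} {a : ℝ} (hp : HasNatDensity p a) {k : ℕ} (hk : 0 < k) :
    HasNatDensity (fun n => ∃ m, n = k * m ∧ p m) (a / k) := by
  have h1 := hp.comp (Nat.tendsto_div_const_atTop hk.ne')
  have h2 := h1.mul (tendsto_natCast_div_div k)
  rw [mul_one_div] at h2
  refine h2.congr fun X => ?_
  simp only [Function.comp_apply]
  rw [natCount_mul p hk]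
  rcases Nat.eq_zero_or_pos (X / k) with h | h
  · simp [h, natCount]
  · rw [div_mul_div_cancel₀]
    exact_mod_cast h.ne'

theorem hasNatDensity_mod_eq {k r : ℕ} (hr0 : 0 < r) (hr : r < k) :
    HasNatDensity (fun n => n % k = r) (1 / k) := by
  have hk : 0 < k := by omega
  have key : ∀ X : ℕ, natCount (fun n => n % k = r) X = X / k + if r ≤ X % k then 1 else 0 := by
    intro X
    have h1 := Nat.count_modEq_card (b := X + 1) hk r
    rw [Nat.count_eq_card_filter_range, Nat.mod_eq_of_lt hr] at h1
    have h2 : natCount (fun n => n % k = r) X = #{x ∈ range (X + 1) | x ≡ r [MOD k]} := by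
      rw [natCount]
      congr 1
      ext n
      simp only [mem_filter, mem_Icc, mem_range, Nat.ModEq, Nat.mod_eq_of_lt hr]
      constructor
      · rintro ⟨h, h'⟩
        exact ⟨by omega, h'⟩
      · rintro ⟨h, h'⟩
        refine ⟨⟨Nat.pos_of_ne_zero ?_, by omega⟩, h'⟩
        rintro rfl
        simp at h'
        omega
    rw [h2, h1]
    have hlt := Nat.mod_lt X hk
    have hX := Nat.div_add_mod X k
    rcases Nat.lt_or_ge (X % k + 1) k with h | h
    · obtain ⟨hq, ht⟩ := (Nat.div_mod_unique (a := X + 1) (d := X / k) (c := X % k + 1) hk).mpr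
        ⟨by omega, h⟩
      rw [hq, ht]
      simp only [Nat.lt_succ_iff]
    · obtain ⟨hq, ht⟩ := (Nat.div_mod_unique (a := X + 1) (d := X / k + 1) (c := 0) hk).mpr
        ⟨by rw [mul_add]; omega, hk⟩
      rw [hq, ht, if_neg (Nat.not_lt_zero r), if_pos (by omega)]
  have h1 := tendsto_natCast_div_div k
  have h2 : Tendsto (fun X : ℕ => (if r ≤ X % k then 1 else 0 : ℝ) / X) atTop (𝓝 0) := by
    refine squeeze_zero (fun X => by positivity) (fun X => ?_) tendsto_one_div_atTop_nhds_zero_nat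
    gcongr
    split_ifs <;> norm_num
  have h3 := h1.add h2
  rw [add_zero] at h3
  refine h3.congr fun X => ?_
  rw [key, ← add_div]
  push_cast
  rfl

theorem sq_dvd_sq_mul_squarefree {a b d : ℕ} (hb : 0 < b) (ha : Squarefree a) :
    d ^ 2 ∣ b ^ 2 * a ↔ d ∣ b := by
  refine ⟨fun h => ?_, fun h => (pow_dvd_pow_of_dvd h 2).mul_right a⟩
  have hg : 0 < d.gcd b := Nat.gcd_pos_of_pos_right d hb
  obtain ⟨d', b', hco, hd, hb'⟩ := Nat.exists_coprime d b
  set g := d.gcd b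
  rw [hd, hb', mul_pow, mul_pow, mul_right_comm] at h
  have h1 := Nat.dvd_of_mul_dvd_mul_right (pow_pos hg 2) h
  have h2 : d' ^ 2 ∣ a := (hco.pow 2 2).dvd_of_dvd_mul_left h1
  have h3 := Nat.isUnit_iff.mp (ha d' (by rwa [← sq]))
  rw [hd, h3, one_mul]
  exact Nat.gcd_dvd_right d b

theorem sum_moebius_sq_dvd {n X : ℕ} (hn : 0 < n) (hX : n ≤ X) :
    ∑ d ∈ Icc 1 X, (if d ^ 2 ∣ n then μ d else 0) = if Squarefree n then 1 else 0 := by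
  obtain ⟨a, b, ha0, hb0, rfl, ha⟩ := Nat.sq_mul_squarefree_of_pos hn
  rw [← sum_filter]
  have h1 : (Icc 1 X).filter (fun d => d ^ 2 ∣ b ^ 2 * a) = b.divisors := by
    ext d
    simp only [mem_filter, mem_Icc, Nat.mem_divisors, sq_dvd_sq_mul_squarefree hb0 ha]
    constructor
    · rintro ⟨_, h⟩
      exact ⟨h, hb0.ne'⟩
    · rintro ⟨h, _⟩
      refine ⟨⟨Nat.pos_of_dvd_of_pos h hb0, (Nat.le_of_dvd hb0 h).trans (le_trans ?_ hX)⟩, h⟩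
      nlinarith [Nat.mul_pos hb0 ha0]
  have h2 : Squarefree (b ^ 2 * a) ↔ b = 1 := by
    constructor
    · intro h
      exact Nat.isUnit_iff.mp (h b ((dvd_of_eq (sq b).symm).mul_right a))
    · rintro rfl
      simpa using ha
  rw [h1, ← coe_mul_zeta_apply, moebius_mul_coe_zeta, one_apply]
  simp only [h2]

/-- The sum of `μ(d) / d²` over odd `d`. -/
theorem tsum_odd_moebius_div_sq :
    ∑' d : ℕ, (if Odd d then (μ d : ℝ) else 0) / (d : ℝ) ^ 2 = 8 / Real.pi ^ 2 := by
  have hs : (1 : ℝ) < (2 : ℂ).re := by norm_num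
  have h1 := DirichletCharacter.LSeries.mul_mu_eq_one (1 : DirichletCharacter ℂ 2) hs
  rw [← DirichletCharacter.LFunction_eq_LSeries _ hs] at h1
  have h2 := DirichletCharacter.LFunctionTrivChar_eq_mul_riemannZeta (N := 2) (s := 2) (by norm_num)
  rw [DirichletCharacter.LFunctionTrivChar] at h2
  rw [h2, riemannZeta_two, Nat.prime_two.primeFactors, prod_singleton] at h1
  have h3 : LSeries ((fun n : ℕ => (1 : DirichletCharacter ℂ 2) n) * fun n : ℕ => ((μ n : ℤ) : ℂ)) 2
      = ((∑' d : ℕ, (if Odd d then (μ d : ℝ) else 0) / (d : ℝ) ^ 2 : ℝ) : ℂ) := by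
    rw [LSeries, Complex.ofReal_tsum]
    refine tsum_congr fun d => ?_
    rw [LSeries.term_def]
    rcases eq_or_ne d 0 with rfl | hd
    · simp
    rw [if_neg hd, Pi.mul_apply]
    by_cases ho : Odd d
    · have hu : IsUnit (d : ZMod 2) := by
        rw [ZMod.isUnit_iff_coprime]
        exact ho.coprime_two_right
      rw [MulChar.one_apply hu]
      simp [ho]
    · have hu : ¬ IsUnit (d : ZMod 2) := by
        rw [ZMod.isUnit_iff_coprime]
        simpa [Nat.coprime_two_right] using ho
      rw [MulChar.map_nonunit _ hu]
      simp [ho]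
  rw [h3] at h1
  have h4 : ((2 : ℕ) : ℂ) ^ (-2 : ℂ) = 1 / 4 := by
    rw [Complex.cpow_neg]
    norm_num
  rw [h4] at h1
  rw [eq_div_iff (by positivity)]
  generalize ∑' d : ℕ, (if Odd d then (μ d : ℝ) else 0) / (d : ℝ) ^ 2 = S at h1 ⊢
  have h5 : (1 - 1 / 4) * (Real.pi ^ 2 / 6) * S = 1 := by
    apply Complex.ofReal_injective
    push_cast
    exact h1
  linarith

theorem natCount_le (p : ℕ → Prop) (X : ℕ) : natCount p X ≤ X :=
  (card_filter_le _ _).trans (by simp)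

theorem natCount_sq_mul_div_le (p : ℕ → Prop) (d X : ℕ) (hd : 0 < d) :
    (natCount (fun n => ∃ m, n = d ^ 2 * m ∧ p m) X : ℝ) / X ≤ 1 / (d : ℝ) ^ 2 := by
  rw [natCount_mul p (pow_pos hd 2)]
  rcases Nat.eq_zero_or_pos X with rfl | hX
  · simp
  have hX' : (0 : ℝ) < X := by exact_mod_cast hX
  rw [div_le_iff₀ hX', one_div_mul_eq_div]
  refine le_trans (Nat.cast_le.mpr (natCount_le p _)) ?_
  exact_mod_cast Nat.cast_div_le (α := ℝ) (m := X) (n := d ^ 2)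

theorem exists_eq_sq_mul_iff {d n r : ℕ} (hd : Odd d) :
    (∃ m, n = d ^ 2 * m ∧ m % 4 = r) ↔ d ^ 2 ∣ n ∧ n % 4 = r := by
  have h (m : ℕ) : (d ^ 2 * m) % 4 = m % 4 := by
    have : d ^ 2 % 4 = 1 := by
      have := Nat.odd_mod_four_iff.mp (Nat.odd_iff.mp hd)
      rcases this with h | h <;> simp [Nat.pow_mod, h]
    simp [Nat.mul_mod, this]
  constructor
  · rintro ⟨m, rfl, hm⟩
    exact ⟨dvd_mul_right _ _, by rw [h, hm]⟩
  · rintro ⟨⟨m, rfl⟩, hm⟩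
    exact ⟨m, rfl, by rw [← h, hm]⟩

theorem natCount_squarefree_mod_four {r : ℕ} (hr : r % 2 = 1) (X : ℕ) :
    (natCount (fun n => n % 4 = r ∧ Squarefree n) X : ℝ) =
      ∑ d ∈ Icc 1 X, (if Odd d then (μ d : ℝ) else 0) *
        natCount (fun n => ∃ m, n = d ^ 2 * m ∧ m % 4 = r) X := by
  have h1 (d : ℕ) : (if Odd d then (μ d : ℝ) else 0) *
        natCount (fun n => ∃ m, n = d ^ 2 * m ∧ m % 4 = r) X =
      ∑ n ∈ Icc 1 X, if n % 4 = r then (((if d ^ 2 ∣ n then μ d else 0 : ℤ)) : ℝ) else 0 := by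
    split_ifs with ho
    · simp only [exists_eq_sq_mul_iff ho]
      rw [natCount, card_filter, Nat.cast_sum, mul_sum]
      refine sum_congr rfl fun n _ => ?_
      by_cases h : d ^ 2 ∣ n <;> by_cases h' : n % 4 = r <;> simp [h, h']
    · rw [zero_mul, eq_comm]
      refine sum_eq_zero fun n _ => ?_
      split_ifs with h h'
      · have h2 : ¬ Odd (d ^ 2) := by simpa [Nat.odd_pow_iff] using ho
        have h3 : Odd n := by rw [Nat.odd_iff]; omega
        exact absurd (h3.of_dvd_nat h') h2
      · simp
      · rfl
  simp only [h1]
  rw [sum_comm, natCount, card_filter, Nat.cast_sum]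
  refine sum_congr rfl fun n hn => ?_
  rw [mem_Icc] at hn
  by_cases h : n % 4 = r
  · simp only [h, if_true]
    rw [← Int.cast_sum, sum_moebius_sq_dvd hn.1 hn.2]
    by_cases h' : Squarefree n <;> simp [h']
  · simp [h]

theorem hasNatDensity_squarefree_mod_four {r : ℕ} (hr : r % 2 = 1) (hr4 : r < 4) :
    HasNatDensity (fun n => n % 4 = r ∧ Squarefree n) (2 / Real.pi ^ 2) := by
  have hsum : Summable fun d : ℕ => 1 / (d : ℝ) ^ 2 :=
    Real.summable_one_div_nat_pow.mpr one_lt_two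
  have hlim := tendsto_tsum_of_dominated_convergence (𝓕 := atTop)
    (f := fun X d : ℕ => (if Odd d then (μ d : ℝ) else 0) *
      ((natCount (fun n => ∃ m, n = d ^ 2 * m ∧ m % 4 = r) X : ℝ) / X))
    (g := fun d : ℕ => (if Odd d then (μ d : ℝ) else 0) * (1 / (4 : ℕ) / (d ^ 2 : ℕ)))
    hsum (fun d => ?_) (Eventually.of_forall fun X d => ?_)
  · have hval : ∑' d : ℕ, (if Odd d then (μ d : ℝ) else 0) * (1 / (4 : ℕ) / (d ^ 2 : ℕ))
        = 2 / Real.pi ^ 2 := by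
      have h : (2 : ℝ) / Real.pi ^ 2 = 1 / 4 * (8 / Real.pi ^ 2) := by ring
      rw [h, ← tsum_odd_moebius_div_sq, ← tsum_mul_left]
      refine tsum_congr fun d => ?_
      push_cast
      ring
    rw [hval] at hlim
    refine hlim.congr fun X => ?_
    rw [natCount_squarefree_mod_four hr, sum_div, tsum_eq_sum (s := Icc 1 X)]
    · exact sum_congr rfl fun d _ => by rw [mul_div_assoc]
    · intro d hd
      rcases Nat.eq_zero_or_pos d with rfl | hd0
      · simp
      have hlt : X < d ^ 2 := by
        simp only [mem_Icc, not_and, not_le] at hd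
        nlinarith [hd hd0]
      rw [natCount_mul _ (pow_pos hd0 2), Nat.div_eq_of_lt hlt]
      simp [natCount]
  · rcases Nat.eq_zero_or_pos d with rfl | hd0
    · simp
    · exact ((hasNatDensity_mod_eq (by omega) hr4).mul (pow_pos hd0 2)).const_mul _
  · rcases Nat.eq_zero_or_pos d with rfl | hd0
    · simp
    rw [norm_mul]
    have h1 : ‖(if Odd d then (μ d : ℝ) else 0)‖ ≤ 1 := by
      split_ifs
      · rw [Real.norm_eq_abs]
        exact_mod_cast abs_moebius_le_one (n := d)
      · simp
    refine (mul_le_of_le_one_left (norm_nonneg _) h1).trans ?_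
    rw [Real.norm_of_nonneg (by positivity)]
    exact natCount_sq_mul_div_le _ d X hd0

theorem squarefree_two_mul_iff (j : ℕ) : Squarefree (2 * j) ↔ j % 2 = 1 ∧ Squarefree j := by
  rw [Nat.squarefree_mul_iff, Nat.coprime_two_left, Nat.odd_iff]
  simp [Nat.prime_two.squarefree]

theorem neg_isFundamentalDiscriminant_iff (n : ℕ) :
    (((-(n : ℤ)) % 4 = 1 ∧ Squarefree (-(n : ℤ))) ∨
        ∃ m : ℤ, (-(n : ℤ)) = 4 * m ∧ Squarefree m ∧ (m % 4 = 2 ∨ m % 4 = 3)) ↔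
      ((n % 4 = 3 ∧ Squarefree n) ∨ ∃ k, n = 4 * k ∧ k % 4 = 1 ∧ Squarefree k) ∨
        ((∃ j, n = 8 * j ∧ j % 4 = 1 ∧ Squarefree j) ∨
          ∃ j, n = 8 * j ∧ j % 4 = 3 ∧ Squarefree j) := by
  have hneg (k : ℕ) : Squarefree (-(k : ℤ)) ↔ Squarefree k := by
    rw [← Int.squarefree_natAbs, Int.natAbs_neg, Int.natAbs_natCast]
  rw [hneg]
  constructor
  · rintro (⟨h, hs⟩ | ⟨m, hm, hs, h⟩)
    · exact Or.inl (Or.inl ⟨by omega, hs⟩)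
    · obtain ⟨k, rfl⟩ : ∃ k : ℕ, m = -(k : ℤ) := ⟨m.natAbs, by omega⟩
      rw [hneg] at hs
      rcases h with h | h
      · obtain ⟨j, rfl⟩ : ∃ j, k = 2 * j := ⟨k / 2, by omega⟩
        rw [squarefree_two_mul_iff] at hs
        obtain h' | h' : j % 4 = 1 ∨ j % 4 = 3 := by omega
        · exact Or.inr (Or.inl ⟨j, by omega, h', hs.2⟩)
        · exact Or.inr (Or.inr ⟨j, by omega, h', hs.2⟩)
      · exact Or.inl (Or.inr ⟨k, by omega, by omega, hs⟩)
  · rintro ((⟨h, hs⟩ | ⟨k, rfl, h, hs⟩) | (⟨j, rfl, h, hs⟩ | ⟨j, rfl, h, hs⟩))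
    · exact Or.inl ⟨by omega, hs⟩
    · exact Or.inr ⟨-(k : ℤ), by push_cast; ring, (hneg k).mpr hs, by omega⟩
    all_goals
      exact Or.inr ⟨-((2 * j : ℕ) : ℤ), by push_cast; ring,
        (hneg _).mpr ((squarefree_two_mul_iff j).mpr ⟨by omega, hs⟩), by omega⟩

/-- The negative fundamental discriminants have natural density `3/π²` among the negative
integers. -/
theorem stmt_16 :
    Filter.Tendsto
      (fun X : ℕ =>
        (((Finset.Icc 1 X).filter (fun n : ℕ =>
            ((-(n : ℤ)) % 4 = 1 ∧ Squarefree (-(n : ℤ))) ∨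
              ∃ m : ℤ, (-(n : ℤ)) = 4 * m ∧ Squarefree m ∧
                (m % 4 = 2 ∨ m % 4 = 3))).card : ℝ) / (X : ℝ))
      Filter.atTop (nhds (3 / Real.pi ^ 2)) := by
  have h1 := hasNatDensity_squarefree_mod_four (r := 1) (by norm_num) (by norm_num)
  have h3 := hasNatDensity_squarefree_mod_four (r := 3) (by norm_num) (by norm_num)
  have h := (h3.or (h1.mul (k := 4) (by norm_num)) ?_).or
    ((h1.mul (k := 8) (by norm_num)).or (h3.mul (k := 8) (by norm_num)) ?_) ?_
  · have hval : 2 / Real.pi ^ 2 + 2 / Real.pi ^ 2 / (4 : ℕ) +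
        (2 / Real.pi ^ 2 / (8 : ℕ) + 2 / Real.pi ^ 2 / (8 : ℕ)) = 3 / Real.pi ^ 2 := by
      push_cast
      ring
    rw [hval] at h
    refine h.congr fun X => ?_
    rw [natCount]
    congr 3
    ext n
    simp only [mem_filter, neg_isFundamentalDiscriminant_iff]
  · rintro n ⟨h, -⟩ ⟨k, rfl, -⟩
    omega
  · rintro n ⟨j, rfl, h, -⟩ ⟨k, hk, h', -⟩
    omega
  · rintro n (⟨h, -⟩ | ⟨k, rfl, h, -⟩) (⟨j, hj, -⟩ | ⟨j, hj, -⟩) <;> omega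
end
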